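/- Let q : ℝ → ℂ be 1-periodic and integrable on [0,1] with Fourier coefficients q_m = 0 for all integers m ≥ 0, and let t ∈ (−π, π]. Then a complex number λ is an eigenvalue of L_t(q) if and only if λ = (2πn + t)² for some integer n. -/

import Mathlib

open Real Complex Set MeasureTheory

/-- The `m`-th Fourier coefficient of `q` on `[0,1]`. -/
noncomputable def fourierCoeff01 (q : ℝ → ℂ) (m : ℤ) : ℂ :=
  ∫ x in (0:ℝ)..1, q x * Complex.exp (-(2 * Real.pi * Complex.I * m) * (x : ℂ))

/-- `y` is an eigenfunction of `L_t(q)` corresponding to `λ`, in the integrated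
(Carathéodory) sense: `y` is continuously differentiable with derivative `g`
satisfying `g x = g 0 + ∫₀ˣ (q − λ) y`, `y` is not identically zero on `[0,1]`,
and `y` satisfies the `t`-quasiperiodic boundary conditions. -/
def IsEigenfunL (q : ℝ → ℂ) (t : ℝ) (lam : ℂ) (y : ℝ → ℂ) : Prop :=
  ∃ g : ℝ → ℂ, ContinuousOn y (Set.Icc (0:ℝ) 1) ∧ ContinuousOn g (Set.Icc (0:ℝ) 1) ∧
    (∀ x ∈ Set.Icc (0:ℝ) 1, y x = y 0 + ∫ s in (0:ℝ)..x, g s) ∧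
    (∀ x ∈ Set.Icc (0:ℝ) 1, g x = g 0 + ∫ s in (0:ℝ)..x, (q s - lam) * y s) ∧
    (¬ ∀ x ∈ Set.Icc (0:ℝ) 1, y x = 0) ∧
    y 1 = Complex.exp (Complex.I * t) * y 0 ∧
    g 1 = Complex.exp (Complex.I * t) * g 0

/-- `λ` is an eigenvalue of `L_t(q)`. -/
def IsEigenvalueL (q : ℝ → ℂ) (t : ℝ) (lam : ℂ) : Prop :=
  ∃ y : ℝ → ℂ, IsEigenfunL q t lam y

/-- The exponential with frequency `2πn + t`. -/
noncomputable def quasiExp (t : ℝ) (n : ℤ) (x : ℝ) : ℂ :=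
  Complex.exp (Complex.I * ((2 * Real.pi * n + t : ℝ) : ℂ) * (x : ℂ))

/-- The coefficient of `f` on `[0,1]` with respect to the exponential `quasiExp t n`. -/
noncomputable def quasiCoeff (t : ℝ) (f : ℝ → ℂ) (n : ℤ) : ℂ :=
  ∫ x in (0:ℝ)..1, f x * Complex.exp (-(Complex.I * ((2 * Real.pi * n + t : ℝ) : ℂ)) * (x : ℂ))

lemma integral_mul_exp (a : ℂ) (u v : ℝ) :
    ∫ x in u..v, a * Complex.exp (a * x) = Complex.exp (a * v) - Complex.exp (a * u) := by
  refine intervalIntegral.integral_eq_sub_of_hasDerivAt (f := fun x : ℝ => Complex.exp (a * x))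
    (fun x _ => ?_) (Continuous.intervalIntegrable (by fun_prop) _ _)
  have h : HasDerivAt (fun x : ℝ => a * (x : ℂ)) a x := by
    simpa using (Complex.ofRealCLM.hasDerivAt (x := x)).const_mul a
  simpa [mul_comm] using h.cexp

/-- Integration by parts for a primitive of an integrable function against an exponential. -/
lemma integral_primitive_mul_exp {f : ℝ → ℂ} (hf : IntervalIntegrable f volume 0 1) (a : ℂ) :
    ∫ x in (0:ℝ)..1, (∫ s in (0:ℝ)..x, f s) * (a * Complex.exp (a * x)) =
      (∫ s in (0:ℝ)..1, f s) * Complex.exp a - ∫ s in (0:ℝ)..1, f s * Complex.exp (a * s) := by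
  set μ := (volume : Measure ℝ).restrict (Ioc (0:ℝ) 1) with hμ
  have hfi : Integrable f μ := (intervalIntegrable_iff_integrableOn_Ioc_of_le zero_le_one).1 hf
  have hcont : Continuous fun x : ℝ => a * Complex.exp (a * x) := by fun_prop
  have hci : Integrable (fun x : ℝ => a * Complex.exp (a * x)) μ :=
    (hcont.integrableOn_Icc (a := 0) (b := 1)).mono_set Ioc_subset_Icc_self
  have hcE : IntervalIntegrable (fun s : ℝ => f s * Complex.exp (a * s)) volume 0 1 :=
    hf.mul_continuousOn (by fun_prop)
  let T : Set (ℝ × ℝ) := {p | p.1 ≤ p.2}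
  have hT : MeasurableSet T := measurableSet_le measurable_fst measurable_snd
  have hint : Integrable (T.indicator fun p : ℝ × ℝ => f p.1 * (a * Complex.exp (a * p.2)))
      (μ.prod μ) := (hfi.mul_prod hci).indicator hT
  have hswap := integral_integral_swap
    (f := fun s x => T.indicator (fun p : ℝ × ℝ => f p.1 * (a * Complex.exp (a * p.2))) (s, x)) hint
  have hleft : ∀ s ∈ Ioc (0:ℝ) 1, ∫ x, T.indicator
      (fun p : ℝ × ℝ => f p.1 * (a * Complex.exp (a * p.2))) (s, x) ∂μ =
      f s * (Complex.exp a - Complex.exp (a * s)) := by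
    intro s hs
    have h1 : ∀ x ∈ Ioc (0:ℝ) 1, T.indicator
        (fun p : ℝ × ℝ => f p.1 * (a * Complex.exp (a * p.2))) (s, x) =
        (Ici s).indicator (fun x : ℝ => f s * (a * Complex.exp (a * x))) x := by
      intro x _
      simp [indicator, T]
    rw [hμ, setIntegral_congr_fun measurableSet_Ioc h1, setIntegral_indicator measurableSet_Ici]
    have h2 : Ioc (0:ℝ) 1 ∩ Ici s = Icc s 1 := by
      ext x; simp only [mem_inter_iff, mem_Ioc, mem_Ici, mem_Icc]
      constructor
      · rintro ⟨⟨_, h⟩, h'⟩; exact ⟨h', h⟩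
      · rintro ⟨h, h'⟩; exact ⟨⟨hs.1.trans_le h, h'⟩, h⟩
    rw [h2, integral_Icc_eq_integral_Ioc, ← intervalIntegral.integral_of_le hs.2,
      intervalIntegral.integral_const_mul, integral_mul_exp]
    simp
  have hright : ∀ x ∈ Ioc (0:ℝ) 1, ∫ s, T.indicator
      (fun p : ℝ × ℝ => f p.1 * (a * Complex.exp (a * p.2))) (s, x) ∂μ =
      (∫ s in (0:ℝ)..x, f s) * (a * Complex.exp (a * x)) := by
    intro x hx
    have h1 : ∀ s ∈ Ioc (0:ℝ) 1, T.indicator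
        (fun p : ℝ × ℝ => f p.1 * (a * Complex.exp (a * p.2))) (s, x) =
        (Iic x).indicator (fun s : ℝ => f s * (a * Complex.exp (a * x))) s := by
      intro s _
      simp [indicator, T]
    rw [hμ, setIntegral_congr_fun measurableSet_Ioc h1, setIntegral_indicator measurableSet_Iic]
    have h2 : Ioc (0:ℝ) 1 ∩ Iic x = Ioc 0 x := by
      rw [Ioc_inter_Iic, min_eq_right hx.2]
    rw [h2, ← intervalIntegral.integral_of_le hx.1.le, intervalIntegral.integral_mul_const]
  rw [intervalIntegral.integral_of_le zero_le_one,
    ← setIntegral_congr_fun measurableSet_Ioc hright, ← hμ, ← hswap, hμ,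
    setIntegral_congr_fun measurableSet_Ioc hleft, ← intervalIntegral.integral_of_le zero_le_one]
  simp_rw [mul_sub]
  rw [intervalIntegral.integral_sub (hf.mul_const _) hcE, intervalIntegral.integral_mul_const]

/-- Coefficients of a quasiperiodic primitive. -/
lemma quasiCoeff_primitive {f F : ℝ → ℂ} {t : ℝ} (hf : IntervalIntegrable f volume 0 1)
    (hF : ∀ x ∈ Icc (0:ℝ) 1, F x = F 0 + ∫ s in (0:ℝ)..x, f s)
    (hFq : F 1 = Complex.exp (Complex.I * t) * F 0) (n : ℤ) :
    quasiCoeff t f n = Complex.I * ((2 * Real.pi * n + t : ℝ) : ℂ) * quasiCoeff t F n := by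
  set a : ℂ := -(Complex.I * ((2 * Real.pi * n + t : ℝ) : ℂ)) with ha
  have hexp : Complex.exp a * Complex.exp (Complex.I * t) = 1 := by
    rw [← Complex.exp_add, Complex.exp_eq_one_iff]
    exact ⟨-n, by rw [ha]; push_cast; ring⟩
  have key := integral_primitive_mul_exp hf a
  have hP : ContinuousOn (fun x => ∫ s in (0:ℝ)..x, f s) (uIcc 0 1) :=
    intervalIntegral.continuousOn_primitive_interval (by
      rw [uIcc_of_le zero_le_one]
      exact (intervalIntegrable_iff_integrableOn_Icc_of_le zero_le_one).1 hf)
  have h1 : a * quasiCoeff t F n =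
      F 0 * (Complex.exp a - 1) +
      ∫ x in (0:ℝ)..1, (∫ s in (0:ℝ)..x, f s) * (a * Complex.exp (a * x)) := by
    have h2 : ∫ x in (0:ℝ)..1, a * Complex.exp (a * x) = Complex.exp a - 1 := by
      rw [integral_mul_exp]; simp
    rw [← h2, ← intervalIntegral.integral_const_mul, ← intervalIntegral.integral_add, quasiCoeff,
      ← intervalIntegral.integral_const_mul]
    · refine intervalIntegral.integral_congr fun x hx => ?_
      rw [uIcc_of_le zero_le_one] at hx
      simp only [← ha]
      rw [hF x hx]; ring
    · exact Continuous.intervalIntegrable (by fun_prop) _ _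
    · exact (hP.mul (by fun_prop)).intervalIntegrable
  have h3 := hF 1 (by simp)
  rw [key] at h1
  have h4 : ∫ s in (0:ℝ)..1, f s = F 1 - F 0 := by rw [h3]; ring
  rw [h4] at h1
  have h5 : ∫ s in (0:ℝ)..1, f s * Complex.exp (a * s) = quasiCoeff t f n := rfl
  rw [h5] at h1
  have h6 : Complex.I * ((2 * Real.pi * n + t : ℝ) : ℂ) = -a := by rw [ha]; ring
  rw [h6]
  linear_combination h1 + Complex.exp a * hFq + F 0 * hexp

/-- A coefficient sequence formally equal to the antiderivative of `f` is realized by a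
quasiperiodic primitive of `f`. -/
lemma exists_primitive_quasiCoeff {f : ℝ → ℂ} {t : ℝ} (hf : IntervalIntegrable f volume 0 1)
    {a : ℤ → ℂ}
    (ha : ∀ n, quasiCoeff t f n = Complex.I * ((2 * Real.pi * n + t : ℝ) : ℂ) * a n) :
    ∃ F : ℝ → ℂ, ContinuousOn F (Icc (0:ℝ) 1) ∧
      (∀ x ∈ Icc (0:ℝ) 1, F x = F 0 + ∫ s in (0:ℝ)..x, f s) ∧
      F 1 = Complex.exp (Complex.I * t) * F 0 ∧ ∀ n, quasiCoeff t F n = a n := by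
  have hP : ContinuousOn (fun x => ∫ s in (0:ℝ)..x, f s) (Icc 0 1) := by
    have := intervalIntegral.continuousOn_primitive_interval (μ := volume) (f := f)
      (a := 0) (b := 1) (by
        rw [uIcc_of_le zero_le_one]
        exact (intervalIntegrable_iff_integrableOn_Icc_of_le zero_le_one).1 hf)
    rwa [uIcc_of_le zero_le_one] at this
  by_cases hex : ∃ m : ℤ, 2 * Real.pi * m + t = 0
  · obtain ⟨m, hm⟩ := hex
    have hcoeff (F : ℝ → ℂ) : quasiCoeff t F m = ∫ x in (0:ℝ)..1, F x := by
      simp [quasiCoeff, hm]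
    have hf0 : ∫ x in (0:ℝ)..1, f x = 0 := by rw [← hcoeff, ha m, hm]; simp
    have het : Complex.exp (Complex.I * t) = 1 := by
      rw [Complex.exp_eq_one_iff]
      refine ⟨-m, ?_⟩
      have : (t : ℂ) = -(2 * Real.pi * m) := by
        have : t = -(2 * Real.pi * m) := by linarith
        rw [this]; push_cast; ring
      rw [this]; push_cast; ring
    set c : ℂ := a m - ∫ x in (0:ℝ)..1, ∫ s in (0:ℝ)..x, f s with hc
    have hF1 : c + ∫ s in (0:ℝ)..1, f s =
        Complex.exp (Complex.I * t) * (c + ∫ s in (0:ℝ)..0, f s) := by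
      rw [hf0, het]; simp
    refine ⟨fun x => c + ∫ s in (0:ℝ)..x, f s, continuousOn_const.add hP, fun x _ => by simp,
      hF1, fun n => ?_⟩
    by_cases hn : 2 * Real.pi * n + t = 0
    · have hnm : n = m := by
        have : 2 * Real.pi * ((n : ℝ) - m) = 0 := by linarith
        have h2 : (n : ℝ) - m = 0 := by
          rcases mul_eq_zero.1 this with h | h
          · exact absurd h (by positivity)
          · exact h
        exact_mod_cast sub_eq_zero.1 h2
      rw [hnm, hcoeff, intervalIntegral.integral_add (by simp)]
      · simp [hc]
      · exact ContinuousOn.intervalIntegrable (by rwa [uIcc_of_le zero_le_one])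
    · have h := quasiCoeff_primitive (F := fun x => c + ∫ s in (0:ℝ)..x, f s) hf
        (fun x _ => by simp) hF1 n
      rw [ha n] at h
      exact (mul_left_cancel₀ (mul_ne_zero Complex.I_ne_zero (by exact_mod_cast hn)) h).symm
  · push Not at hex
    have het : Complex.exp (Complex.I * t) - 1 ≠ 0 := by
      rw [sub_ne_zero, Ne, Complex.exp_eq_one_iff]
      rintro ⟨m, hm⟩
      apply hex (-m)
      have h2 : (t : ℂ) = 2 * Real.pi * m := by
        apply mul_left_cancel₀ Complex.I_ne_zero
        rw [hm]; ring
      have h3 : t = 2 * Real.pi * m := by exact_mod_cast h2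
      rw [h3]; push_cast; ring
    set c : ℂ := (∫ s in (0:ℝ)..1, f s) / (Complex.exp (Complex.I * t) - 1) with hc
    have hF1 : c + ∫ s in (0:ℝ)..1, f s =
        Complex.exp (Complex.I * t) * (c + ∫ s in (0:ℝ)..0, f s) := by
      have : c * (Complex.exp (Complex.I * t) - 1) = ∫ s in (0:ℝ)..1, f s := by
        rw [hc]; field_simp
      rw [← this]; simp; ring
    refine ⟨fun x => c + ∫ s in (0:ℝ)..x, f s, continuousOn_const.add hP, fun x _ => by simp,
      hF1, fun n => ?_⟩
    have h := quasiCoeff_primitive (F := fun x => c + ∫ s in (0:ℝ)..x, f s) hf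
      (fun x _ => by simp) hF1 n
    rw [ha n] at h
    exact (mul_left_cancel₀ (mul_ne_zero Complex.I_ne_zero (by exact_mod_cast hex n)) h).symm

lemma norm_quasiExp (t : ℝ) (n : ℤ) (x : ℝ) : ‖quasiExp t n x‖ = 1 := by
  rw [quasiExp, mul_assoc, ← Complex.ofReal_mul, mul_comm, Complex.norm_exp_ofReal_mul_I]

lemma continuous_quasiExp (t : ℝ) (n : ℤ) : Continuous (quasiExp t n) := by
  unfold quasiExp; fun_prop

/-- A continuous quasiperiodic function with summable coefficients is the sum of its series. -/
lemma hasSum_quasiCoeff {F : ℝ → ℂ} {t : ℝ} (hF : ContinuousOn F (Icc (0:ℝ) 1))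
    (hFq : F 1 = Complex.exp (Complex.I * t) * F 0) (hs : Summable (quasiCoeff t F))
    {x : ℝ} (hx : x ∈ Icc (0:ℝ) 1) :
    HasSum (fun n => quasiCoeff t F n * quasiExp t n x) (F x) := by
  set G : ℝ → ℂ := fun x => F x * Complex.exp (-(Complex.I * t) * x) with hG
  have hG01 : G 0 = G 1 := by
    simp only [hG, hFq]
    rw [mul_comm (Complex.exp _), mul_assoc, ← Complex.exp_add]
    simp
  have hGc : ContinuousOn G (Icc 0 1) := hF.mul (by fun_prop)
  have : Fact ((0:ℝ) < 1) := ⟨one_pos⟩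
  let φ : C(AddCircle (1:ℝ), ℂ) := ⟨AddCircle.liftIco 1 0 G,
    AddCircle.liftIco_zero_continuous hG01 hGc⟩
  have hco : ∀ n, fourierCoeff φ n = quasiCoeff t F n := by
    intro n
    change fourierCoeff (AddCircle.liftIco 1 0 G) n = _
    rw [fourierCoeff_liftIco_eq, fourierCoeffOn_eq_integral, quasiCoeff]
    simp only [zero_add, sub_zero, div_one, one_smul]
    refine intervalIntegral.integral_congr fun x _ => ?_
    simp only [fourier_coe_apply, hG, smul_eq_mul]
    rw [mul_left_comm, ← Complex.exp_add]
    congr 2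
    push_cast; ring
  have hφ : ∀ x ∈ Icc (0:ℝ) 1, φ (x : AddCircle (1:ℝ)) = G x := by
    intro x hx
    rcases hx.2.lt_or_eq with h | h
    · change AddCircle.liftIco 1 0 G x = G x
      exact AddCircle.liftIco_zero_coe_apply ⟨hx.1, h⟩
    · have h0 : φ ((0:ℝ) : AddCircle (1:ℝ)) = G 0 := by
        change AddCircle.liftIco 1 0 G ((0:ℝ) : AddCircle (1:ℝ)) = G 0
        exact AddCircle.liftIco_zero_coe_apply ⟨le_rfl, one_pos⟩
      rw [h, ← hG01, ← h0]
      congr 1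
      simp
  have hsum := has_pointwise_sum_fourier_series_of_summable (f := φ)
    (by rwa [show fourierCoeff φ = quasiCoeff t F from funext hco]) (x : AddCircle (1:ℝ))
  rw [hφ x hx] at hsum
  have h := hsum.mul_left (Complex.exp (Complex.I * t * x))
  convert! h using 1
  · ext n
    rw [hco, fourier_coe_apply, smul_eq_mul, mul_left_comm, ← Complex.exp_add, quasiExp]
    congr 2
    push_cast; ring
  · simp only [hG]
    rw [mul_left_comm, ← Complex.exp_add]
    simp

/-- Coefficients of the product of an integrable function with an absolutely convergent series. -/
lemma hasSum_quasiCoeff_mul {q y : ℝ → ℂ} {t : ℝ} {c : ℤ → ℂ}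
    (hq : IntervalIntegrable q volume 0 1) (hc : Summable fun n => ‖c n‖)
    (hy : ∀ x ∈ Icc (0:ℝ) 1, HasSum (fun n => c n * quasiExp t n x) (y x)) (n : ℤ) :
    HasSum (fun k => c k * fourierCoeff01 q (n - k)) (quasiCoeff t (fun x => q x * y x) n) := by
  have hexp : ∀ (k : ℤ) (x : ℝ),
      ‖Complex.exp (-(2 * Real.pi * Complex.I * k) * (x : ℂ))‖ = 1 := by
    intro k x
    rw [show -(2 * Real.pi * Complex.I * k) * (x : ℂ) = ((-(2 * Real.pi * k * x) : ℝ) : ℂ) *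
      Complex.I by push_cast; ring, Complex.norm_exp_ofReal_mul_I]
  have hqi : IntegrableOn q (Ioc 0 1) :=
    (intervalIntegrable_iff_integrableOn_Ioc_of_le zero_le_one).1 hq
  set f : ℤ → ℝ → ℂ := fun k x =>
    c k * (q x * Complex.exp (-(2 * Real.pi * Complex.I * (n - k : ℤ)) * (x : ℂ))) with hf
  have hfi : ∀ k, IntegrableOn (f k) (Ioc 0 1) := fun k =>
    (intervalIntegrable_iff_integrableOn_Ioc_of_le zero_le_one).1
      ((hq.mul_continuousOn (by fun_prop)).const_mul _)
  have key := hasSum_integral_of_summable_integral_norm (F := f) hfi (by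
    have : ∀ k, ∫ x in Ioc (0:ℝ) 1, ‖f k x‖ = ‖c k‖ * ∫ x in Ioc (0:ℝ) 1, ‖q x‖ := by
      intro k
      rw [← integral_const_mul]
      simp only [hf, norm_mul, hexp, mul_one]
    simp_rw [this]
    exact hc.mul_right _)
  convert! key using 1
  · ext k
    simp only [hf, fourierCoeff01]
    rw [intervalIntegral.integral_of_le zero_le_one, integral_const_mul]
  · rw [quasiCoeff, intervalIntegral.integral_of_le zero_le_one]
    refine setIntegral_congr_fun measurableSet_Ioc fun x hx => ?_
    have h := ((hy x (Ioc_subset_Icc_self hx)).mul_left (q x)).mul_right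
      (Complex.exp (-(Complex.I * ((2 * Real.pi * n + t : ℝ) : ℂ)) * (x : ℂ)))
    rw [← h.tsum_eq]
    refine tsum_congr fun k => ?_
    simp only [hf, quasiExp]
    rw [mul_left_comm (q x), mul_assoc, mul_assoc, ← Complex.exp_add]
    congr 3
    push_cast; ring

lemma summable_inv_sq_sub (t : ℝ) (lam : ℂ) :
    Summable fun n : ℤ => ‖((2 * Real.pi * n + t : ℝ) : ℂ) ^ 2 - lam‖⁻¹ := by
  have hs : Summable fun n : ℤ => 2 * (1 / (n : ℝ) ^ 2) :=
    (Real.summable_one_div_int_pow.2 one_lt_two).mul_left 2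
  refine hs.of_norm_bounded_eventually ?_
  have hev : ∀ᶠ n : ℤ in Filter.cofinite, 2 * ‖lam‖ + |t| + 1 ≤ ‖(n : ℝ)‖ :=
    (tendsto_norm_cocompact_atTop.comp Int.tendsto_coe_cofinite).eventually_ge_atTop _
  filter_upwards [hev] with n hn
  rw [Real.norm_eq_abs] at hn
  have hl := norm_nonneg lam
  have ht := abs_nonneg t
  have hn0 : 0 < |(n : ℝ)| := by linarith
  have h1 : |(n : ℝ)| ≤ |2 * Real.pi * n + t| := by
    have h2 : |2 * Real.pi * (n : ℝ)| - |t| ≤ |2 * Real.pi * n + t| := by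
      simpa using abs_sub_abs_le_abs_sub (2 * Real.pi * (n : ℝ)) (-t)
    have h3 : |2 * Real.pi * (n : ℝ)| = 2 * Real.pi * |(n : ℝ)| := by
      rw [abs_mul, abs_of_pos Real.two_pi_pos]
    nlinarith [Real.pi_gt_three]
  have h4 : (n : ℝ) ^ 2 ≤ (2 * Real.pi * n + t) ^ 2 := sq_le_sq.2 h1
  have h5 : 2 * ‖lam‖ ≤ (n : ℝ) ^ 2 := by rw [← sq_abs]; nlinarith
  have h6 : (n : ℝ) ^ 2 / 2 ≤ ‖((2 * Real.pi * n + t : ℝ) : ℂ) ^ 2 - lam‖ := by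
    have h7 := norm_sub_norm_le (((2 * Real.pi * n + t : ℝ) : ℂ) ^ 2) lam
    rw [norm_pow, Complex.norm_real, Real.norm_eq_abs, sq_abs] at h7
    linarith
  have h8 : 0 < (n : ℝ) ^ 2 := by rw [← sq_abs]; positivity
  rw [norm_inv, norm_norm, show 2 * (1 / (n : ℝ) ^ 2) = ((n : ℝ) ^ 2 / 2)⁻¹ by field_simp]
  exact inv_anti₀ (by positivity) h6

/-- A summable sequence each of whose terms is controlled by its tail vanishes. -/
lemma eq_zero_of_norm_le_mul_tail {c : ℤ → ℂ} {d : ℤ → ℝ} (hc : Summable fun n => ‖c n‖)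
    (hd : Summable d) (hd0 : ∀ n, 0 ≤ d n)
    (h : ∀ n, ‖c n‖ ≤ d n * ∑' k, (Ioi n).indicator (fun k => ‖c k‖) k) (n : ℤ) : c n = 0 := by
  set T : ℤ → ℝ := fun n => ∑' k, (Ioi n).indicator (fun k => ‖c k‖) k
  obtain ⟨N, hN⟩ : ∃ N : ℤ, ∑' k, (Ioi N).indicator d k < 1 := by
    obtain ⟨s, hs⟩ := ((tendsto_tsum_compl_atTop_zero d).eventually_lt_const one_pos).exists
    obtain ⟨N, hN⟩ := s.bddAbove
    refine ⟨N, lt_of_le_of_lt ?_ hs⟩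
    have h1 : ∑' a : { x // x ∉ s }, d a = ∑' k, ({x | x ∉ s} : Set ℤ).indicator d k :=
      tsum_subtype ({x | x ∉ s} : Set ℤ) d
    rw [h1]
    refine Summable.tsum_le_tsum (fun k => ?_) (hd.indicator _) (hd.indicator _)
    refine indicator_le_indicator_of_subset (fun k hk hks => ?_) hd0 k
    exact absurd (hN hks) (not_le.2 hk)
  have hTN : T N ≤ (∑' k, (Ioi N).indicator d k) * T N := by
    rw [← tsum_mul_right]
    refine Summable.tsum_le_tsum (fun k => ?_) (hc.indicator _) ((hd.indicator _).mul_right _)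
    by_cases hk : k ∈ Ioi N
    · rw [indicator_of_mem hk, indicator_of_mem hk]
      refine (h k).trans (mul_le_mul_of_nonneg_left ?_ (hd0 k))
      refine Summable.tsum_le_tsum (fun j => ?_) (hc.indicator _) (hc.indicator _)
      exact indicator_le_indicator_of_subset (Ioi_subset_Ioi (le_of_lt hk))
        (fun j => norm_nonneg (c j)) j
    · rw [indicator_of_notMem hk, indicator_of_notMem hk, zero_mul]
  have hT0 : T N ≤ 0 := by nlinarith
  have hbase : ∀ k, N < k → c k = 0 := by
    intro k hk
    have h1 : (Ioi N).indicator (fun k => ‖c k‖) k ≤ T N :=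
      (hc.indicator (Ioi N)).le_tsum k fun j _ => indicator_nonneg (fun _ _ => norm_nonneg _) j
    rw [indicator_of_mem (mem_Ioi.2 hk)] at h1
    exact norm_le_zero_iff.1 (h1.trans hT0)
  have hall : ∀ j : ℕ, ∀ k, N - j < k → c k = 0 := by
    intro j
    induction j with
    | zero => simpa using hbase
    | succ j ih =>
      intro k hk
      rcases lt_or_ge (N - j) k with h1 | h1
      · exact ih k h1
      · have hzero : ∀ i, (Ioi k).indicator (fun k => ‖c k‖) i = 0 := by
          intro i
          by_cases hi : i ∈ Ioi k
          · rw [indicator_of_mem hi, ih i (by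
              have : k < i := hi
              push_cast at hk; omega), norm_zero]
          · exact indicator_of_notMem hi _
        have h2 := h k
        simp only [hzero, tsum_zero, mul_zero] at h2
        exact norm_le_zero_iff.1 h2
  exact hall ((N - n).toNat + 1) n (by push_cast; omega)

/-- Solution of the triangular recursion `a j = b j * ∑_{i < j} K j i * a i`, with `a 0 = 1`. -/
noncomputable def triangularSeq (b : ℕ → ℂ) (K : ℕ → ℕ → ℂ) : ℕ → ℂ
  | 0 => 1
  | j + 1 => b (j + 1) * ∑ i : Fin (j + 1), K (j + 1) i * triangularSeq b K i
termination_by j => j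
decreasing_by exact i.2

lemma triangularSeq_of_pos (b : ℕ → ℂ) (K : ℕ → ℕ → ℂ) {j : ℕ} (hj : 0 < j) :
    triangularSeq b K j = b j * ∑ i ∈ Finset.range j, K j i * triangularSeq b K i := by
  obtain ⟨j, rfl⟩ := Nat.exists_eq_succ_of_ne_zero hj.ne'
  rw [triangularSeq, Finset.sum_range]

lemma summable_triangularSeq {b : ℕ → ℂ} {K : ℕ → ℕ → ℂ} {Q : ℝ} (hb : Summable fun j => ‖b j‖)
    (hQ : 0 ≤ Q) (hK : ∀ j i, ‖K j i‖ ≤ Q) : Summable fun j => ‖triangularSeq b K j‖ := by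
  set a := triangularSeq b K with ha
  have hbound : ∀ j, ∑ i ∈ Finset.range j, ‖a i‖ ≤
      Real.exp (∑ i ∈ Finset.range j, Q * ‖b i‖) := by
    intro j
    induction j with
    | zero => simp
    | succ j ih =>
      rcases Nat.eq_zero_or_pos j with rfl | hj
      · simp only [zero_add, Finset.sum_range_one]
        rw [ha, triangularSeq, norm_one]
        exact Real.one_le_exp (by positivity)
      · rw [Finset.sum_range_succ, Finset.sum_range_succ, Real.exp_add]
        have h1 : ‖a j‖ ≤ Q * ‖b j‖ * ∑ i ∈ Finset.range j, ‖a i‖ := by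
          rw [ha, triangularSeq_of_pos b K hj, norm_mul, mul_comm Q, mul_assoc]
          refine mul_le_mul_of_nonneg_left ?_ (norm_nonneg _)
          rw [Finset.mul_sum]
          refine (norm_sum_le _ _).trans (Finset.sum_le_sum fun i _ => ?_)
          rw [norm_mul]
          exact mul_le_mul_of_nonneg_right (hK j i) (norm_nonneg _)
        have h2 : 0 ≤ ∑ i ∈ Finset.range j, ‖a i‖ := Finset.sum_nonneg fun _ _ => norm_nonneg _
        calc _ ≤ (∑ i ∈ Finset.range j, ‖a i‖) * (Q * ‖b j‖ + 1) := by linarith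
          _ ≤ _ := mul_le_mul ih (Real.add_one_le_exp _) (by positivity) (Real.exp_pos _).le
  refine summable_of_sum_range_le (c := Real.exp (∑' i, Q * ‖b i‖)) (fun _ => norm_nonneg _)
    fun j => (hbound j).trans (Real.exp_le_exp.2 ?_)
  exact (hb.mul_left Q).sum_le_tsum _ fun _ _ => by positivity

lemma norm_fourierCoeff01_le (q : ℝ → ℂ) (m : ℤ) :
    ‖fourierCoeff01 q m‖ ≤ ∫ x in (0:ℝ)..1, ‖q x‖ := by
  refine (intervalIntegral.norm_integral_le_integral_norm zero_le_one).trans_eq ?_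
  refine intervalIntegral.integral_congr fun x _ => ?_
  rw [norm_mul, show -(2 * Real.pi * Complex.I * m) * (x : ℂ) =
    ((-(2 * Real.pi * m * x) : ℝ) : ℂ) * Complex.I by push_cast; ring,
    Complex.norm_exp_ofReal_mul_I, mul_one]

lemma fourierCoeff01_one (m : ℤ) : fourierCoeff01 (fun _ => 1) m = if m = 0 then 1 else 0 := by
  split_ifs with hm
  · simp [fourierCoeff01, hm]
  · have h := integral_mul_exp (-(2 * Real.pi * Complex.I * m)) 0 1
    have h1 : Complex.exp (-(2 * Real.pi * Complex.I * m)) = 1 :=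
      Complex.exp_eq_one_iff.2 ⟨-m, by push_cast; ring⟩
    rw [intervalIntegral.integral_const_mul] at h
    simp only [Complex.ofReal_one, mul_one, h1, Complex.ofReal_zero, mul_zero, Complex.exp_zero,
      sub_self] at h
    have hne : -(2 * Real.pi * Complex.I * (m : ℂ)) ≠ 0 := by
      simp [Real.pi_ne_zero, hm]
    simpa [fourierCoeff01] using (mul_eq_zero.1 h).resolve_left hne

lemma quasiCoeff_sub_const_mul {q y : ℝ → ℂ} {t : ℝ} {lam : ℂ}
    (hq : IntervalIntegrable q volume 0 1) (hy : ContinuousOn y (Icc (0:ℝ) 1)) (n : ℤ) :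
    quasiCoeff t (fun x => (q x - lam) * y x) n =
      quasiCoeff t (fun x => q x * y x) n - lam * quasiCoeff t y n := by
  have hy' : ContinuousOn y (uIcc 0 1) := by rwa [uIcc_of_le zero_le_one]
  simp only [quasiCoeff]
  rw [← intervalIntegral.integral_const_mul, ← intervalIntegral.integral_sub]
  · refine intervalIntegral.integral_congr fun x _ => ?_
    ring
  · exact (hq.mul_continuousOn hy').mul_continuousOn (by fun_prop)
  · exact ((hy'.mul (by fun_prop)).intervalIntegrable).const_mul _

/-- Coefficients of an eigenfunction satisfy the eigenvalue equation. -/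
lemma IsEigenfunL.quasiCoeff_eq {q y : ℝ → ℂ} {t : ℝ} {lam : ℂ}
    (hq : IntervalIntegrable q volume 0 1) (h : IsEigenfunL q t lam y) (n : ℤ) :
    (((2 * Real.pi * n + t : ℝ) : ℂ) ^ 2 - lam) * quasiCoeff t y n =
      -quasiCoeff t (fun x => q x * y x) n := by
  obtain ⟨g, hyc, hgc, hyg, hgh, -, hy1, hg1⟩ := h
  have hy' : ContinuousOn y (uIcc 0 1) := by rwa [uIcc_of_le zero_le_one]
  have hg' : ContinuousOn g (uIcc 0 1) := by rwa [uIcc_of_le zero_le_one]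
  have h1 := quasiCoeff_primitive hg'.intervalIntegrable hyg hy1 n
  have h2 := quasiCoeff_primitive
    ((hq.sub (intervalIntegrable_const (c := lam))).mul_continuousOn hy') hgh hg1 n
  have h3 := quasiCoeff_sub_const_mul (t := t) (lam := lam) hq hyc n
  rw [h3, h1] at h2
  linear_combination h2 + ((2 * Real.pi * n + t : ℝ) : ℂ) ^ 2 * quasiCoeff t y n * Complex.I_sq

/-- Triangularity: an eigenvalue must coincide with a free eigenvalue. -/
lemma exists_int_of_isEigenvalueL {q : ℝ → ℂ} (hq : IntervalIntegrable q volume 0 1)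
    (hfour : ∀ m : ℤ, 0 ≤ m → fourierCoeff01 q m = 0) {t : ℝ} {lam : ℂ}
    (h : IsEigenvalueL q t lam) : ∃ n : ℤ, lam = (((2 * Real.pi * n + t : ℝ) : ℂ)) ^ 2 := by
  by_contra! hne
  obtain ⟨y, hy⟩ := h
  have heq := hy.quasiCoeff_eq hq
  obtain ⟨g, hyc, -, -, -, hy0, hy1, -⟩ := hy
  set D : ℤ → ℝ := fun n => ‖((2 * Real.pi * n + t : ℝ) : ℂ) ^ 2 - lam‖⁻¹ with hD
  have hDs : Summable D := summable_inv_sq_sub t lam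
  have hD0 : ∀ n, 0 ≤ D n := fun n => inv_nonneg.2 (norm_nonneg _)
  have hnorm : ∀ n, ‖quasiCoeff t y n‖ = D n * ‖quasiCoeff t (fun x => q x * y x) n‖ := by
    intro n
    have h1 := congrArg norm (heq n)
    rw [norm_mul, norm_neg] at h1
    have h2 : ‖((2 * Real.pi * n + t : ℝ) : ℂ) ^ 2 - lam‖ ≠ 0 :=
      norm_ne_zero_iff.2 (sub_ne_zero.2 (hne n).symm)
    simp only [hD]
    rw [← h1, inv_mul_cancel_left₀ h2]
  have hsum : Summable fun n => ‖quasiCoeff t y n‖ := by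
    refine (hDs.mul_right (∫ x in (0:ℝ)..1, ‖q x * y x‖)).of_nonneg_of_le
      (fun n => norm_nonneg _) fun n => ?_
    rw [hnorm n]
    refine mul_le_mul_of_nonneg_left ?_ (hD0 n)
    refine (intervalIntegral.norm_integral_le_integral_norm zero_le_one).trans_eq ?_
    refine intervalIntegral.integral_congr fun x _ => ?_
    rw [norm_mul _ (Complex.exp _), show -(Complex.I * ((2 * Real.pi * n + t : ℝ) : ℂ)) * (x : ℂ) =
      ((-((2 * Real.pi * n + t) * x) : ℝ) : ℂ) * Complex.I by push_cast; ring,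
      Complex.norm_exp_ofReal_mul_I, mul_one]
  have hser := fun x hx => hasSum_quasiCoeff hyc hy1 hsum.of_norm (x := x) hx
  set Q : ℝ := ∫ x in (0:ℝ)..1, ‖q x‖
  have hQ : 0 ≤ Q := (norm_nonneg _).trans (norm_fourierCoeff01_le q 0)
  have hzero := eq_zero_of_norm_le_mul_tail (d := fun n => D n * Q) hsum (hDs.mul_right Q)
    (fun n => mul_nonneg (hD0 n) hQ) fun n => by
      rw [hnorm n, mul_assoc, ← tsum_mul_left]
      refine mul_le_mul_of_nonneg_left ?_ (hD0 n)
      have hconv := hasSum_quasiCoeff_mul hq hsum hser n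
      rw [← hconv.tsum_eq]
      refine tsum_of_norm_bounded ((hsum.indicator (Ioi n)).mul_left Q).hasSum fun k => ?_
      by_cases hk : k ∈ Ioi n
      · rw [indicator_of_mem hk, norm_mul, mul_comm]
        exact mul_le_mul_of_nonneg_right (norm_fourierCoeff01_le q _) (norm_nonneg _)
      · rw [hfour _ (sub_nonneg.2 (not_lt.1 hk)), indicator_of_notMem hk]
        simp
  refine hy0 fun x hx => ?_
  have h1 := hser x hx
  simp only [hzero, zero_mul] at h1
  exact h1.unique hasSum_zero

/-- A summable formal eigenvector defines an eigenfunction. -/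
lemma isEigenvalueL_of_coeff {q : ℝ → ℂ} (hq : IntervalIntegrable q volume 0 1)
    {t : ℝ} {lam : ℂ} {c : ℤ → ℂ} (hc : Summable fun n => ‖c n‖) (hc0 : ∃ n, c n ≠ 0)
    (hrec : ∀ n, HasSum (fun k => c k * fourierCoeff01 q (n - k))
      ((lam - ((2 * Real.pi * n + t : ℝ) : ℂ) ^ 2) * c n)) :
    IsEigenvalueL q t lam := by
  have hbd : ∀ (n : ℤ) (x : ℝ), ‖c n * quasiExp t n x‖ ≤ ‖c n‖ := fun n x => by
    rw [norm_mul, norm_quasiExp, mul_one]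
  set y : ℝ → ℂ := fun x => ∑' n, c n * quasiExp t n x with hy
  have hyc : Continuous y :=
    continuous_tsum (fun n => (continuous_quasiExp t n).const_mul _) hc hbd
  have hsum : ∀ x ∈ Icc (0:ℝ) 1, HasSum (fun n => c n * quasiExp t n x) (y x) := fun x _ =>
    (Summable.of_norm_bounded hc fun n => hbd n x).hasSum
  have hcoeff : ∀ n, quasiCoeff t y n = c n := by
    intro n
    have h := hasSum_quasiCoeff_mul (q := fun _ => 1) (by simp) hc hsum n
    simp only [one_mul, fourierCoeff01_one] at h
    refine h.unique ?_
    convert! hasSum_ite_eq n (c n) using 1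
    ext k
    by_cases hk : k = n
    · simp [hk]
    · simp [hk, sub_eq_zero, Ne.symm hk]
  have hh : IntervalIntegrable (fun x => (q x - lam) * y x) volume 0 1 :=
    (hq.sub (intervalIntegrable_const (c := lam))).mul_continuousOn hyc.continuousOn
  obtain ⟨g, hgc, hgh, hg1, hgn⟩ := exists_primitive_quasiCoeff (t := t) hh
    (a := fun n => Complex.I * ((2 * Real.pi * n + t : ℝ) : ℂ) * c n) fun n => by
      rw [quasiCoeff_sub_const_mul hq hyc.continuousOn, hcoeff,
        (hasSum_quasiCoeff_mul hq hc hsum n).unique (hrec n)]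
      linear_combination -((2 * Real.pi * n + t : ℝ) : ℂ) ^ 2 * c n * Complex.I_sq
  have hg' : ContinuousOn g (uIcc 0 1) := by rwa [uIcc_of_le zero_le_one]
  obtain ⟨Y, hYc, hYg, hY1, hYn⟩ := exists_primitive_quasiCoeff (t := t)
    hg'.intervalIntegrable (a := c) hgn
  have hYy : ∀ x ∈ Icc (0:ℝ) 1, Y x = y x := by
    intro x hx
    have h := hasSum_quasiCoeff hYc hY1 (by rw [funext hYn]; exact hc.of_norm) hx
    simp only [hYn] at h
    exact h.unique (hsum x hx)
  refine ⟨Y, g, hYc, hgc, hYg, fun x hx => ?_, fun hY0 => ?_, hY1, hg1⟩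
  · rw [hgh x hx]
    congr 1
    refine intervalIntegral.integral_congr fun s hs => ?_
    rw [uIcc_of_le hx.1] at hs
    rw [hYy s ⟨hs.1, hs.2.trans hx.2⟩]
  · obtain ⟨n, hn⟩ := hc0
    apply hn
    rw [← hYn n, quasiCoeff, intervalIntegral.integral_congr (g := fun _ => (0:ℂ))]
    · simp
    · intro x hx
      rw [uIcc_of_le zero_le_one] at hx
      simp [hY0 x hx]

/-- Every free eigenvalue is attained at a smallest index. -/
lemma exists_least_sq_eq {t : ℝ} {lam : ℂ}
    (h : ∃ n : ℤ, lam = (((2 * Real.pi * n + t : ℝ) : ℂ)) ^ 2) :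
    ∃ N : ℤ, lam = (((2 * Real.pi * N + t : ℝ) : ℂ)) ^ 2 ∧
      ∀ n < N, (((2 * Real.pi * n + t : ℝ) : ℂ)) ^ 2 - lam ≠ 0 := by
  have hbdd : ∃ B : ℤ, ∀ n : ℤ, lam = (((2 * Real.pi * n + t : ℝ) : ℂ)) ^ 2 → B ≤ n := by
    obtain ⟨m, hm⟩ := h
    refine ⟨min m ⌊-(t / Real.pi) - m⌋, fun n hn => ?_⟩
    rw [hm, sq_eq_sq_iff_eq_or_eq_neg] at hn
    have hpi := Real.pi_pos
    rcases hn with hn | hn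
    · have h1 : 2 * Real.pi * m + t = 2 * Real.pi * n + t := by exact_mod_cast hn
      have h2 : (m : ℝ) = n := mul_left_cancel₀ Real.two_pi_pos.ne' (by linarith)
      have h3 : m = n := by exact_mod_cast h2
      exact h3 ▸ min_le_left _ _
    · have h1 : 2 * Real.pi * m + t = -(2 * Real.pi * n + t) := by exact_mod_cast hn
      have h2 : (n : ℝ) = -(t / Real.pi) - m := by
        field_simp
        linarith
      exact (min_le_right _ _).trans (by rw [← h2, Int.floor_intCast])
  obtain ⟨N, hN, hmin⟩ := Int.exists_least_of_bdd hbdd h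
  exact ⟨N, hN, fun n hn h0 => absurd (hmin n (sub_eq_zero.1 h0).symm) (not_le.2 hn)⟩

lemma isEigenvalueL_of_exists_int {q : ℝ → ℂ} (hq : IntervalIntegrable q volume 0 1)
    (hfour : ∀ m : ℤ, 0 ≤ m → fourierCoeff01 q m = 0) {t : ℝ} {lam : ℂ}
    (h : ∃ n : ℤ, lam = (((2 * Real.pi * n + t : ℝ) : ℂ)) ^ 2) : IsEigenvalueL q t lam := by
  obtain ⟨N, hN, hlt⟩ := exists_least_sq_eq h
  set b : ℕ → ℂ := fun j => (((2 * Real.pi * (N - j : ℤ) + t : ℝ) : ℂ) ^ 2 - lam)⁻¹ with hb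
  set K : ℕ → ℕ → ℂ := fun j i => -fourierCoeff01 q (i - j) with hK
  have hinj : Function.Injective fun j : ℕ => N - (j : ℤ) := fun i j hij => by
    simp only at hij; omega
  have hbs : Summable fun j => ‖b j‖ := by
    have := (summable_inv_sq_sub t lam).comp_injective hinj
    simpa only [hb, norm_inv, Function.comp_def] using this
  have hQ : 0 ≤ ∫ x in (0:ℝ)..1, ‖q x‖ := (norm_nonneg _).trans (norm_fourierCoeff01_le q 0)
  have has := summable_triangularSeq (K := K) hbs hQ fun j i => by
    rw [hK, norm_neg]; exact norm_fourierCoeff01_le q _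
  set a := triangularSeq b K with ha
  set c : ℤ → ℂ := fun k => if k ≤ N then a (N - k).toNat else 0 with hcdef
  have hcN : ∀ j : ℕ, c (N - j) = a j := fun j => by simp [hcdef]
  have hc0 : ∀ k, k ∉ range (fun j : ℕ => N - (j : ℤ)) → c k = 0 := by
    intro k hk
    simp only [hcdef]
    rw [if_neg]
    intro hkN
    exact hk ⟨(N - k).toNat, by simp only; omega⟩
  refine isEigenvalueL_of_coeff (c := c) hq ?_ ⟨N, ?_⟩ fun n => ?_
  · refine (hinj.summable_iff fun k hk => by rw [hc0 k hk, norm_zero]).1 ?_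
    simpa only [Function.comp_def, hcN] using has
  · have := hcN 0
    simp only [Nat.cast_zero, sub_zero] at this
    rw [this, ha, triangularSeq]
    exact one_ne_zero
  · rcases lt_or_ge N n with hn | hn
    · have hz : ∀ k, c k * fourierCoeff01 q (n - k) = 0 := by
        intro k
        rcases lt_or_ge N k with hk | hk
        · simp [hcdef, not_le.2 hk]
        · rw [hfour _ (by omega), mul_zero]
      have hcn : c n = 0 := by simp [hcdef, not_le.2 hn]
      simp only [hz, hcn, mul_zero]
      exact hasSum_zero
    · obtain ⟨j, rfl⟩ : ∃ j : ℕ, n = N - j := ⟨(N - n).toNat, by omega⟩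
      refine (hinj.hasSum_iff fun k hk => by rw [hc0 k hk, zero_mul]).1 ?_
      have hterm : ∀ i : ℕ, c (N - i) * fourierCoeff01 q (N - j - (N - i)) = -(K j i * a i) := by
        intro i
        rw [hcN, show N - (j : ℤ) - (N - i) = i - j by ring, hK]
        ring
      have hval : (lam - ((2 * Real.pi * (N - j : ℤ) + t : ℝ) : ℂ) ^ 2) * c (N - j) =
          ∑ i ∈ Finset.range j, -(K j i * a i) := by
        rw [hcN, Finset.sum_neg_distrib]
        rcases Nat.eq_zero_or_pos j with rfl | hj
        · simp [hN]
        · have hne := hlt (N - j) (by omega)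
          rw [ha, triangularSeq_of_pos b K hj, ← ha, ← neg_sub, neg_mul]
          simp only [hb]
          rw [mul_inv_cancel_left₀ hne]
      rw [hval]
      simp only [Function.comp_def, hterm]
      refine hasSum_sum_of_ne_finset_zero fun i hi => ?_
      rw [Finset.mem_range, not_lt] at hi
      simp only [hK]
      rw [hfour _ (by omega)]
      simp

theorem spectrum_L_gasymov_neg (q : ℝ → ℂ) (hper : ∀ x : ℝ, q (x + 1) = q x)
    (hint : IntegrableOn q (Set.Icc (0:ℝ) 1))
    (hfour : ∀ m : ℤ, 0 ≤ m → fourierCoeff01 q m = 0)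
    (t : ℝ) (ht : t ∈ Set.Ioc (-Real.pi) Real.pi) :
    ∀ lam : ℂ, IsEigenvalueL q t lam ↔
      ∃ n : ℤ, lam = (((2 * Real.pi * n + t : ℝ) : ℂ))^2 := by
  intro lam
  have hq : IntervalIntegrable q volume 0 1 :=
    (intervalIntegrable_iff_integrableOn_Icc_of_le zero_le_one).2 hint
  exact ⟨exists_int_of_isEigenvalueL hq hfour, isEigenvalueL_of_exists_int hq hfour⟩
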